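/- arXiv:1911.13167 — 2 statements merged into one kernel-verified Lean document; each statement's English description precedes it below -/
import Mathlib

section
/- The free energy F(ℓ) := sup_{τ∈ℝ} ( τℓ − β⁻¹ G(τ) ) is finite and continuously differentiable on ℝ; its derivative τ(·) := F' is the inverse function of ℓ(·) := β⁻¹ G'; τ is continuously differentiable; and c₁ ≤ τ'(ℓ) ≤ c₂ for every ℓ ∈ ℝ (equivalently, 1/c₂ ≤ ℓ'(τ) ≤ 1/c₁ for every τ ∈ ℝ). In particular the tension τ(·) is a Lipschitz, strictly increasing bijection of ℝ. -/
open MeasureTheory Real Set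

/-- The canonical Gibbs function `G(τ) = log ∫ exp(-βV(r) + βτr) dr`. -/
noncomputable def gibbsG (β : ℝ) (V : ℝ → ℝ) (τ : ℝ) : ℝ :=
  Real.log (∫ r : ℝ, Real.exp (-β * V r + β * τ * r))

/-- The free energy `F(ℓ) = sup_τ (τℓ - β⁻¹ G(τ))`. -/
noncomputable def freeEnergy (β : ℝ) (V : ℝ → ℝ) (ℓ : ℝ) : ℝ :=
  ⨆ τ : ℝ, (τ * ℓ - β⁻¹ * gibbsG β V τ)

/-- The measure with density `exp (-U)` with respect to Lebesgue measure. -/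
noncomputable def gibbsMeasure (U : ℝ → ℝ) : Measure ℝ :=
  volume.withDensity fun r => ENNReal.ofReal (exp (-U r))

section Convex

variable {f : ℝ → ℝ} {a b : ℝ}

lemma Monotone.le_of_deriv_eq_zero (hf : Differentiable ℝ f) (hm : Monotone (deriv f))
    {x : ℝ} (hx : deriv f x = 0) (y : ℝ) : f x ≤ f y := by
  have hd : derivWithin f (Ioi x) x = 0 := by
    rw [(hf x).derivWithin (uniqueDiffWithinAt_Ioi x), hx]
  exact isMinOn_univ_iff.1
    ((hm.convexOn_univ_of_deriv hf).isMinOn_of_rightDeriv_eq_zero (by simp) hd) y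

lemma mul_sq_le_sub_mul_sub_of_le_deriv (hf : Differentiable ℝ f) (ha : ∀ x, a ≤ deriv f x)
    (x y : ℝ) : a * (x - y) ^ 2 ≤ (f x - f y) * (x - y) := by
  rcases le_total x y with h | h
  · have := mul_sub_le_image_sub_of_le_deriv hf ha h
    nlinarith
  · have := mul_sub_le_image_sub_of_le_deriv hf ha h
    nlinarith

lemma sub_mul_sub_le_mul_sq_of_deriv_le (hf : Differentiable ℝ f) (hb : ∀ x, deriv f x ≤ b)
    (x y : ℝ) : (f x - f y) * (x - y) ≤ b * (x - y) ^ 2 := by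
  rcases le_total x y with h | h
  · have := image_sub_le_mul_sub_of_deriv_le hf hb h
    nlinarith
  · have := image_sub_le_mul_sub_of_deriv_le hf hb h
    nlinarith

lemma quadratic_le_of_le_deriv_deriv (hf : Differentiable ℝ f) (hf' : Differentiable ℝ (deriv f))
    (ha : ∀ x, a ≤ deriv (deriv f) x) (x : ℝ) :
    f 0 + deriv f 0 * x + a / 2 * x ^ 2 ≤ f x := by
  set g : ℝ → ℝ := fun x => f x - (deriv f 0 * x + a / 2 * x ^ 2) with hg
  have hgd (x : ℝ) : HasDerivAt g (deriv f x - (deriv f 0 + a * x)) x := by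
    have h1 := ((hasDerivAt_id' x).const_mul (deriv f 0)).fun_add
      (((hasDerivAt_id' x).fun_pow 2).const_mul (a / 2))
    exact ((hf x).hasDerivAt.fun_sub h1).congr_deriv (by push_cast; ring)
  have hgd' : deriv g = fun x => deriv f x - (deriv f 0 + a * x) := funext fun x => (hgd x).deriv
  have hm : Monotone (deriv g) := by
    intro x y hxy
    have := mul_sub_le_image_sub_of_le_deriv hf' ha hxy
    simp only [hgd']
    nlinarith
  have := hm.le_of_deriv_eq_zero (fun x => (hgd x).differentiableAt) (x := 0) (by simp [hgd']) x
  simp only [hg] at this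
  linarith

end Convex

section Legendre

/-- The Legendre transform of a function with `0 < a ≤ g'' ≤ b`. -/
lemma legendre_properties {g : ℝ → ℝ} {a b : ℝ} (ha : 0 < a) (hg : ContDiff ℝ 2 g)
    (hga : ∀ x, a ≤ deriv (deriv g) x) (hgb : ∀ x, deriv (deriv g) x ≤ b) :
    ∃ T : ℝ → ℝ, ContDiff ℝ 1 T ∧ (∀ x, T (deriv g x) = x) ∧ (∀ y, deriv g (T y) = y) ∧
      (∀ y, b⁻¹ ≤ deriv T y ∧ deriv T y ≤ a⁻¹) ∧
      (∀ y, BddAbove (range fun x => x * y - g x)) ∧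
      ∀ y, HasDerivAt (fun y => ⨆ x, (x * y - g x)) (T y) y := by
  have hgd : Differentiable ℝ g := hg.differentiable (by norm_num)
  have hg1 : ContDiff ℝ 1 (deriv g) := by
    have : ContDiff ℝ (1 + 1) g := by simpa [one_add_one_eq_two] using hg
    exact (contDiff_succ_iff_deriv.1 this).2.2
  have hg'd : Differentiable ℝ (deriv g) := hg1.differentiable (by norm_num)
  have hpos (x : ℝ) : 0 < deriv (deriv g) x := ha.trans_le (hga x)
  have hmono : StrictMono (deriv g) := strictMono_of_deriv_pos hpos
  have hsurj : Function.Surjective (deriv g) := by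
    apply hg1.continuous.surjective
    · refine Filter.tendsto_atTop_mono' _ ?_ (Filter.tendsto_atTop_add_const_left _ (deriv g 0)
        (Filter.tendsto_id.const_mul_atTop ha))
      filter_upwards [Filter.eventually_ge_atTop 0] with x hx
      have := mul_sub_le_image_sub_of_le_deriv hg'd hga hx
      simp only [id]
      linarith
    · refine Filter.tendsto_atBot_mono' _ ?_ (Filter.tendsto_atBot_add_const_left _ (deriv g 0)
        (Filter.tendsto_id.const_mul_atBot ha))
      filter_upwards [Filter.eventually_le_atBot 0] with x hx
      have := mul_sub_le_image_sub_of_le_deriv hg'd hga hx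
      simp only [id]
      linarith
  set e : ℝ ≃ₜ ℝ := (hmono.orderIsoOfSurjective _ hsurj).toHomeomorph
  set T : ℝ → ℝ := ⇑e.symm
  have hTg (x : ℝ) : T (deriv g x) = x := e.symm_apply_apply x
  have hgT (y : ℝ) : deriv g (T y) = y := e.apply_symm_apply y
  have hT1 : ContDiff ℝ 1 T :=
    e.contDiff_symm_deriv (fun x => (hpos x).ne') (fun x => (hg'd x).hasDerivAt) hg1
  have hTd (y : ℝ) : HasDerivAt T (deriv (deriv g) (T y))⁻¹ y :=
    HasDerivAt.of_local_left_inverse hT1.continuous.continuousAt (hg'd _).hasDerivAt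
      (hpos _).ne' (Filter.Eventually.of_forall hgT)
  have hmax (y x : ℝ) : x * y - g x ≤ T y * y - g (T y) := by
    have hd (x : ℝ) : HasDerivAt (fun x => g x - x * y) (deriv g x - y) x := by
      simpa using (hgd x).hasDerivAt.fun_sub ((hasDerivAt_id' x).mul_const y)
    have hd' : deriv (fun x => g x - x * y) = fun x => deriv g x - y :=
      funext fun x => (hd x).deriv
    have hm : Monotone (deriv fun x => g x - x * y) := by
      rw [hd']
      exact fun u v huv => sub_le_sub_right (hmono.monotone huv) y
    have := hm.le_of_deriv_eq_zero (fun x => (hd x).differentiableAt) (x := T y)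
      (by simp [hd', hgT]) x
    linarith
  have hbdd (y : ℝ) : BddAbove (range fun x => x * y - g x) :=
    ⟨_, forall_mem_range.2 (hmax y)⟩
  have hsup : (fun y => ⨆ x, (x * y - g x)) = fun y => T y * y - g (T y) :=
    funext fun y => le_antisymm (ciSup_le (hmax y)) (le_ciSup (hbdd y) (T y))
  refine ⟨T, hT1, hTg, hgT, fun y => ?_, hbdd, fun y => ?_⟩
  · rw [(hTd y).deriv]
    exact ⟨inv_anti₀ (hpos _) (hgb _), inv_anti₀ ha (hga _)⟩
  · rw [hsup]
    refine (((hTd y).fun_mul (hasDerivAt_id' y)).fun_sub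
      ((hgd (T y)).hasDerivAt.comp y (hTd y))).congr_deriv ?_
    rw [hgT]
    ring

end Legendre

section Gibbs

variable {U : ℝ → ℝ} {a b : ℝ}

lemma integrable_gibbsMeasure_iff (hU : Continuous U) (f : ℝ → ℝ) :
    Integrable f (gibbsMeasure U) ↔ Integrable fun r => exp (-U r) * f r := by
  rw [gibbsMeasure, integrable_withDensity_iff_integrable_smul' (by fun_prop) (by simp)]
  simp [ENNReal.toReal_ofReal (exp_pos _).le]

lemma integral_gibbsMeasure (hU : Continuous U) (f : ℝ → ℝ) :
    ∫ r, f r ∂gibbsMeasure U = ∫ r, exp (-U r) * f r := by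
  rw [gibbsMeasure, integral_withDensity_eq_integral_toReal_smul (by fun_prop) (by simp)]
  simp [ENNReal.toReal_ofReal (exp_pos _).le]

lemma integrable_exp_neg_add_mul (ha : 0 < a) (hU : Differentiable ℝ U)
    (hU' : Differentiable ℝ (deriv U)) (hUa : ∀ x, a ≤ deriv (deriv U) x) (t : ℝ) :
    Integrable fun r => exp (-U r) * exp (t * r) := by
  have hUc := hU.continuous
  set s := t - deriv U 0
  have hg := ((integrable_exp_neg_mul_sq (b := a / 2) (by positivity)).comp_sub_right
    (s / a)).const_mul (exp (-U 0 + s ^ 2 / (2 * a)))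
  refine hg.mono' (by fun_prop) (Filter.Eventually.of_forall fun r => ?_)
  rw [← exp_add, ← exp_add, norm_of_nonneg (exp_pos _).le, exp_le_exp]
  have h := quadratic_le_of_le_deriv_deriv hU hU' hUa r
  have : -U 0 + s ^ 2 / (2 * a) + -(a / 2) * (r - s / a) ^ 2 = -U 0 + s * r - a / 2 * r ^ 2 := by
    field_simp
    ring
  rw [this]
  simp only [s]
  linarith

lemma integrableExpSet_gibbsMeasure (ha : 0 < a) (hU : Differentiable ℝ U)
    (hU' : Differentiable ℝ (deriv U)) (hUa : ∀ x, a ≤ deriv (deriv U) x) :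
    ProbabilityTheory.integrableExpSet id (gibbsMeasure U) = univ :=
  eq_univ_of_forall fun t => (integrable_gibbsMeasure_iff hU.continuous _).2
    (integrable_exp_neg_add_mul ha hU hU' hUa t)

lemma integrable_pow_mul_exp_neg_add_mul (ha : 0 < a) (hU : Differentiable ℝ U)
    (hU' : Differentiable ℝ (deriv U)) (hUa : ∀ x, a ≤ deriv (deriv U) x) (t : ℝ) (n : ℕ) :
    Integrable fun r => r ^ n * (exp (-U r) * exp (t * r)) := by
  have h := ProbabilityTheory.integrable_pow_mul_exp_of_mem_interior_integrableExpSet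
    (X := id) (μ := gibbsMeasure U) (v := t)
    (by simp [integrableExpSet_gibbsMeasure ha hU hU' hUa]) n
  refine ((integrable_gibbsMeasure_iff hU.continuous _).1 h).congr
    (Filter.Eventually.of_forall fun r => ?_)
  simp only [id]
  ring

/-- Integration by parts, combined with strong convexity of the potential: the variance of the
Gibbs measure is between the inverses of the bounds on the second derivative of the potential. -/
lemma cgf_gibbsMeasure_deriv_deriv_bounds (ha : 0 < a) (hU : Differentiable ℝ U)
    (hU' : Differentiable ℝ (deriv U)) (hUa : ∀ x, a ≤ deriv (deriv U) x)
    (hUb : ∀ x, deriv (deriv U) x ≤ b) (t : ℝ) :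
    a * deriv (deriv (ProbabilityTheory.cgf id (gibbsMeasure U))) t ≤ 1 ∧
      1 ≤ b * deriv (deriv (ProbabilityTheory.cgf id (gibbsMeasure U))) t := by
  have hUc := hU.continuous
  have hU'c := hU'.continuous
  have ht : t ∈ interior (ProbabilityTheory.integrableExpSet id (gibbsMeasure U)) := by
    simp [integrableExpSet_gibbsMeasure ha hU hU' hUa]
  set m := deriv (ProbabilityTheory.cgf id (gibbsMeasure U)) t with hm
  set w : ℝ → ℝ := fun r => exp (-U r) * exp (t * r) with hw
  have hwc : Continuous w := by fun_prop
  have hw0 (r : ℝ) : 0 < w r := by positivity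
  have hint (n : ℕ) : Integrable fun r => r ^ n * w r :=
    integrable_pow_mul_exp_neg_add_mul ha hU hU' hUa t n
  have hint0 : Integrable w := by simpa using hint 0
  have hint1 : Integrable fun r => (r - m) * w r := by
    refine ((hint 1).sub (hint0.const_mul m)).congr (Filter.Eventually.of_forall fun r => ?_)
    simp only [Pi.sub_apply]
    ring
  have hint2 : Integrable fun r => (r - m) ^ 2 * w r := by
    refine (((hint 2).sub ((hint 1).const_mul (2 * m))).add (hint0.const_mul (m ^ 2))).congr
      (Filter.Eventually.of_forall fun r => ?_)
    simp only [Pi.sub_apply, Pi.add_apply]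
    ring
  have hZ : 0 < ∫ r, w r := by
    refine (integral_pos_iff_support_of_nonneg (fun r => (hw0 r).le) hint0).2 ?_
    simp [Function.support_eq_univ fun r => (hw0 r).ne']
  have hmgf : ProbabilityTheory.mgf id (gibbsMeasure U) t = ∫ r, w r := by
    simp [ProbabilityTheory.mgf, integral_gibbsMeasure hUc, hw]
  have hcenter : ∫ r, (r - m) * w r = 0 := by
    have h1 : m * ∫ r, w r = ∫ r, r * w r := by
      rw [hm, ProbabilityTheory.deriv_cgf ht, hmgf, integral_gibbsMeasure hUc,
        div_mul_cancel₀ _ hZ.ne']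
      refine integral_congr_ae (Filter.Eventually.of_forall fun r => ?_)
      simp only [id, hw]
      ring
    have h2 : ∫ r, (r - m) * w r = (∫ r, r * w r) - m * ∫ r, w r := by
      rw [← integral_const_mul, ← integral_sub (by simpa using hint 1) (hint0.const_mul m)]
      simp only [sub_mul]
    rw [h2, h1, sub_self]
  have hvar : deriv (deriv (ProbabilityTheory.cgf id (gibbsMeasure U))) t * ∫ r, w r =
      ∫ r, (r - m) ^ 2 * w r := by
    have := ProbabilityTheory.iteratedDeriv_two_cgf_eq_integral ht
    rw [iteratedDeriv_succ, iteratedDeriv_one] at this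
    rw [this, hmgf, integral_gibbsMeasure hUc, div_mul_cancel₀ _ hZ.ne']
    refine integral_congr_ae (Filter.Eventually.of_forall fun r => ?_)
    simp only [id, hw]
    ring
  have hlow (r : ℝ) := mul_sq_le_sub_mul_sub_of_le_deriv hU' hUa r m
  have hupp (r : ℝ) := sub_mul_sub_le_mul_sq_of_deriv_le hU' hUb r m
  have hintU : Integrable fun r => (deriv U r - deriv U m) * (r - m) * w r := by
    refine (hint2.const_mul b).mono' (by fun_prop) (Filter.Eventually.of_forall fun r => ?_)
    have : 0 ≤ (deriv U r - deriv U m) * (r - m) := le_trans (by positivity) (hlow r)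
    rw [norm_of_nonneg (mul_nonneg this (hw0 r).le)]
    exact (mul_le_mul_of_nonneg_right (hupp r) (hw0 r).le).trans_eq (mul_assoc _ _ _)
  have hparts : ∫ r, (deriv U r - deriv U m) * (r - m) * w r = ∫ r, w r := by
    have hd (r : ℝ) : HasDerivAt (fun r => (r - m) * w r)
        (w r - (deriv U r - deriv U m) * (r - m) * w r + (t - deriv U m) * ((r - m) * w r)) r := by
      have h1 := (hU r).hasDerivAt.fun_neg.exp.fun_mul (((hasDerivAt_id' r).const_mul t).exp)
      refine (((hasDerivAt_id' r).sub_const m).fun_mul h1).congr_deriv ?_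
      simp only [hw]
      ring
    have h := integral_eq_zero_of_hasDerivAt_of_integrable hd
      ((hint0.sub hintU).add (hint1.const_mul _)) hint1
    rw [integral_add (by exact hint0.sub hintU) (hint1.const_mul _), integral_sub hint0 hintU,
      integral_const_mul, hcenter] at h
    linarith
  have hA : a * ∫ r, (r - m) ^ 2 * w r ≤ ∫ r, w r := by
    rw [← hparts, ← integral_const_mul]
    refine integral_mono (hint2.const_mul a) hintU fun r => ?_
    exact (mul_assoc _ _ _).symm.trans_le (mul_le_mul_of_nonneg_right (hlow r) (hw0 r).le)
  have hB : ∫ r, w r ≤ b * ∫ r, (r - m) ^ 2 * w r := by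
    rw [← hparts, ← integral_const_mul]
    refine integral_mono hintU (hint2.const_mul b) fun r => ?_
    exact (mul_le_mul_of_nonneg_right (hupp r) (hw0 r).le).trans_eq (mul_assoc _ _ _)
  rw [← hvar, ← mul_assoc] at hA hB
  exact ⟨le_of_mul_le_mul_right (by simpa using hA) hZ,
    le_of_mul_le_mul_right (by simpa using hB) hZ⟩

lemma contDiff_cgf_gibbsMeasure (ha : 0 < a) (hU : Differentiable ℝ U)
    (hU' : Differentiable ℝ (deriv U)) (hUa : ∀ x, a ≤ deriv (deriv U) x) :
    ContDiff ℝ 2 (ProbabilityTheory.cgf id (gibbsMeasure U)) :=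
  contDiff_iff_contDiffAt.2 fun t => (ProbabilityTheory.analyticAt_cgf
    (by simp [integrableExpSet_gibbsMeasure ha hU hU' hUa])).contDiffAt

end Gibbs

lemma gibbsG_eq_cgf {β : ℝ} {V : ℝ → ℝ} (hV : Continuous V) (τ : ℝ) :
    gibbsG β V τ = ProbabilityTheory.cgf id (gibbsMeasure fun r => β * V r) (β * τ) := by
  rw [gibbsG, ProbabilityTheory.cgf, ProbabilityTheory.mgf, integral_gibbsMeasure (by fun_prop)]
  simp only [← exp_add, id, neg_mul]

/-- The free energy `F` is finite and `C¹`; its derivative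
`τ(·) = F'` is the inverse of `ℓ(·) = β⁻¹ G'`, is `C¹`, and satisfies
`c₁ ≤ τ'(ℓ) ≤ c₂`; in particular `τ(·)` is a Lipschitz strictly increasing
bijection of `ℝ`. -/
theorem freeEnergy_properties
    (β c₁ c₂ : ℝ) (V : ℝ → ℝ)
    (hβ : 0 < β) (hc₁ : 0 < c₁) (hc₁₂ : c₁ ≤ c₂)
    (hV : ContDiff ℝ 2 V)
    (hV'' : ∀ r : ℝ, c₁ ≤ deriv (deriv V) r ∧ deriv (deriv V) r ≤ c₂) :
    (∀ ℓ : ℝ, BddAbove (Set.range fun τ : ℝ => τ * ℓ - β⁻¹ * gibbsG β V τ)) ∧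
    ContDiff ℝ 1 (freeEnergy β V) ∧
    ContDiff ℝ 1 (deriv (freeEnergy β V)) ∧
    (∀ τ : ℝ, deriv (freeEnergy β V) (β⁻¹ * deriv (gibbsG β V) τ) = τ) ∧
    (∀ ℓ : ℝ, β⁻¹ * deriv (gibbsG β V) (deriv (freeEnergy β V) ℓ) = ℓ) ∧
    (∀ ℓ : ℝ, c₁ ≤ deriv (deriv (freeEnergy β V)) ℓ ∧
      deriv (deriv (freeEnergy β V)) ℓ ≤ c₂) ∧
    LipschitzWith (Real.toNNReal c₂) (deriv (freeEnergy β V)) ∧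
    StrictMono (deriv (freeEnergy β V)) ∧
    Function.Bijective (deriv (freeEnergy β V)) := by
  have hVd : Differentiable ℝ V := hV.differentiable (by norm_num)
  have hV'd : Differentiable ℝ (deriv V) := by
    have : ContDiff ℝ (1 + 1) V := by simpa [one_add_one_eq_two] using hV
    exact (contDiff_succ_iff_deriv.1 this).2.2.differentiable (by norm_num)
  set U : ℝ → ℝ := fun r => β * V r
  have hUd : Differentiable ℝ U := hVd.const_mul β
  have hU' : deriv U = fun r => β * deriv V r := funext fun r => deriv_const_mul_field β
  have hU'd : Differentiable ℝ (deriv U) := hU' ▸ hV'd.const_mul β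
  have hU'' (r : ℝ) : deriv (deriv U) r = β * deriv (deriv V) r := by
    rw [hU', deriv_const_mul_field]
  have hUa (r : ℝ) : β * c₁ ≤ deriv (deriv U) r :=
    hU'' r ▸ mul_le_mul_of_nonneg_left (hV'' r).1 hβ.le
  have hUb (r : ℝ) : deriv (deriv U) r ≤ β * c₂ :=
    hU'' r ▸ mul_le_mul_of_nonneg_left (hV'' r).2 hβ.le
  have hc₂ : 0 < c₂ := hc₁.trans_le hc₁₂
  have ha : 0 < β * c₁ := by positivity
  set K := ProbabilityTheory.cgf id (gibbsMeasure U)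
  have hK2 : ContDiff ℝ 2 K := contDiff_cgf_gibbsMeasure ha hUd hU'd hUa
  have hKb := cgf_gibbsMeasure_deriv_deriv_bounds ha hUd hU'd hUa hUb
  have hG : gibbsG β V = fun τ => K (β * τ) := funext fun τ => gibbsG_eq_cgf hVd.continuous τ
  have hG' : deriv (gibbsG β V) = fun τ => β * deriv K (β * τ) := by
    rw [hG]
    exact funext fun τ => deriv_comp_mul_left β K τ
  set g : ℝ → ℝ := fun τ => β⁻¹ * gibbsG β V τ with hg
  have hg2 : ContDiff ℝ 2 g := by
    simp only [hg, hG]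
    fun_prop
  have hg' : deriv g = fun τ => β⁻¹ * deriv (gibbsG β V) τ :=
    funext fun τ => deriv_const_mul_field _
  have hg'' (τ : ℝ) : deriv (deriv g) τ = β * deriv (deriv K) (β * τ) := by
    have : deriv g = fun τ => deriv K (β * τ) := by
      rw [hg', hG']
      exact funext fun τ => inv_mul_cancel_left₀ hβ.ne' _
    rw [this]
    exact deriv_comp_mul_left β (deriv K) τ
  obtain ⟨T, hT1, hTg, hgT, hTb, hbdd, hF⟩ := legendre_properties (g := g) (a := c₂⁻¹)
    (b := c₁⁻¹) (by positivity) hg2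
    (fun τ => by
      rw [hg'', inv_le_iff_one_le_mul₀' hc₂]
      linarith [(hKb (β * τ)).2])
    (fun τ => by
      rw [hg'', ← one_div, le_div_iff₀ hc₁]
      linarith [(hKb (β * τ)).1])
  simp only [inv_inv] at hTb
  have hFd : deriv (freeEnergy β V) = T := funext fun ℓ => (hF ℓ).deriv
  have hmono : StrictMono T := strictMono_of_deriv_pos fun ℓ => hc₁.trans_le (hTb ℓ).1
  simp only [hg'] at hTg hgT
  rw [hFd]
  refine ⟨hbdd, ?_, hT1, hTg, hgT, hTb, ?_, hmono, hmono.injective, fun τ => ⟨_, hTg τ⟩⟩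
  · exact contDiff_one_iff_deriv.2 ⟨fun ℓ => (hF ℓ).differentiableAt, hFd ▸ hT1.continuous⟩
  · refine lipschitzWith_of_nnnorm_deriv_le (hT1.differentiable (by norm_num)) fun ℓ => ?_
    rw [← NNReal.coe_le_coe, coe_nnnorm, coe_toNNReal _ hc₂.le,
      norm_of_nonneg (hc₁.le.trans (hTb ℓ).1)]
    exact (hTb ℓ).2
end

section
/- There exists a constant C, depending only on β and c₂, with the following property (two-block estimate, force version). For all integers l ≥ 1 and N ≥ 2l+1, and every smooth strictly positive probability density f with respect to λ^N_{β,τ₀}: Σ_{i=l+1}^{N−l} ∫ ( V̄'_{l,i+l} − V̄'_{l,i} )² f dλ^N_{β,τ₀} ≤ C ( N/l + l² · D̃(f) ), where V̄'_{l,i} := (1/l) Σ_{j=1}^{l} V'(r_{i−j+1}). -/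
open MeasureTheory Real Set Finset
open scoped ENNReal

/-- One-site Gibbs density `exp(-βV(r) + βτr - G(τ))`. -/
noncomputable def gibbsDensity (β : ℝ) (V : ℝ → ℝ) (τ r : ℝ) : ℝ :=
  Real.exp (-β * V r + β * τ * r - gibbsG β V τ)

/-- The `N`-fold product Gibbs measure `λ^N_{β,τ}` on `ℝ^N`. -/
noncomputable def gibbsPi (β : ℝ) (V : ℝ → ℝ) (τ : ℝ) (N : ℕ) : Measure (Fin N → ℝ) :=
  volume.withDensity fun x => ENNReal.ofReal (∏ i, gibbsDensity β V τ (x i))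

/-- The coordinates `r_1, …, r_N` (1-indexed), extended by `0` out of range. -/
noncomputable def coord {N : ℕ} (x : Fin N → ℝ) (n : ℕ) : ℝ :=
  if h : n - 1 < N then x ⟨n - 1, h⟩ else 0

/-- Block average of the forces: `V̄'_{l,i} = (1/l) Σ_{j=1}^{l} V'(r_{i-j+1})`. -/
noncomputable def forceBlockAvg (V : ℝ → ℝ) {N : ℕ} (l i : ℕ) (x : Fin N → ℝ) : ℝ :=
  (1 / (l : ℝ)) * ∑ j ∈ Finset.Icc 1 l, deriv V (coord x (i - j + 1))

/-- The stretch Dirichlet form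
`D̃(f) = Σ_{j=1}^{N-1} ∫ (∂f/∂r_{j+1} - ∂f/∂r_j)²/f dλ^N`. -/
noncomputable def stretchDirichlet (β : ℝ) (V : ℝ → ℝ) (τ : ℝ) (N : ℕ)
    (f : (Fin N → ℝ) → ℝ) : ℝ≥0∞ :=
  ∑ j : Fin (N - 1),
    ∫⁻ x, ENNReal.ofReal
      ((fderiv ℝ f x (Pi.single (⟨j.1 + 1, by have := j.isLt; omega⟩ : Fin N) 1) -
        fderiv ℝ f x (Pi.single (⟨j.1, by have := j.isLt; omega⟩ : Fin N) 1)) ^ 2 / f x)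
      ∂(gibbsPi β V τ N)

section Cutoff

variable {E : Type*} [NormedAddCommGroup E] [NormedSpace ℝ E] [FiniteDimensional ℝ E]

/-- Smooth compactly supported cutoffs increasing to `1`, with gradient of order `1 / n`. -/
theorem exists_cutoff_sequence (v : E) :
    ∃ (φ : ℕ → E → ℝ) (M : ℝ), (∀ n, ContDiff ℝ 1 (φ n)) ∧ (∀ n, HasCompactSupport (φ n)) ∧
      (∀ n x, 0 ≤ φ n x ∧ φ n x ≤ 1) ∧ (∀ x, ∀ᶠ n in Filter.atTop, φ n x = 1) ∧
      ∀ n x, |fderiv ℝ (φ n) x v| ≤ M / ((n : ℝ) + 1) := by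
  let χ : ContDiffBump (0 : E) := ⟨1, 2, one_pos, one_lt_two⟩
  have hχ : ContDiff ℝ 1 (χ : E → ℝ) := χ.contDiff
  have hcont : Continuous fun x => fderiv ℝ (χ : E → ℝ) x v :=
    (hχ.continuous_fderiv one_ne_zero).clm_apply continuous_const
  have hsupp : HasCompactSupport fun x => fderiv ℝ (χ : E → ℝ) x v :=
    χ.hasCompactSupport.fderiv_apply ℝ v
  obtain ⟨M, hM⟩ := hcont.bounded_above_of_compact_support hsupp
  refine ⟨fun n x => χ (((n : ℝ) + 1)⁻¹ • x), M, fun n => ?_, fun n => ?_, fun n x => ?_,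
    fun x => ?_, fun n x => ?_⟩
  · exact hχ.comp (contDiff_const_smul _)
  · exact χ.hasCompactSupport.comp_smul (by positivity)
  · exact ⟨χ.nonneg, χ.le_one⟩
  · obtain ⟨m, hm⟩ := exists_nat_gt ‖x‖
    filter_upwards [Filter.eventually_ge_atTop m] with n hn
    refine χ.one_of_mem_closedBall ?_
    have hmn : (m : ℝ) ≤ n := by exact_mod_cast hn
    have hpos : (0 : ℝ) < (n : ℝ) + 1 := by positivity
    rw [mem_closedBall_zero_iff, norm_smul, norm_inv, Real.norm_of_nonneg hpos.le,
      inv_mul_le_iff₀ hpos]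
    change ‖x‖ ≤ ((n : ℝ) + 1) * 1
    linarith
  · have hpos : (0 : ℝ) < (n : ℝ) + 1 := by positivity
    have h := ((hχ.differentiable one_ne_zero (((n : ℝ) + 1)⁻¹ • x)).hasFDerivAt.comp x
      ((hasFDerivAt_id x).const_smul ((n : ℝ) + 1)⁻¹)).fderiv
    have h' : fderiv ℝ (fun x => χ (((n : ℝ) + 1)⁻¹ • x)) x v =
        ((n : ℝ) + 1)⁻¹ * fderiv ℝ (χ : E → ℝ) (((n : ℝ) + 1)⁻¹ • x) v := by
      change fderiv ℝ ((χ : E → ℝ) ∘ HSMul.hSMul ((n : ℝ) + 1)⁻¹) x v = _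
      rw [h]
      simp
    rw [h', abs_mul, abs_of_pos (inv_pos.2 hpos), div_eq_inv_mul]
    gcongr
    exact hM _

variable [MeasurableSpace E] [BorelSpace E] {μ : Measure E} [μ.IsAddHaarMeasure]

theorem integral_fderiv_eq_zero_of_hasCompactSupport {h : E → ℝ} (hh : ContDiff ℝ 1 h)
    (hc : HasCompactSupport h) (v : E) :
    Integrable (fun x => fderiv ℝ h x v) μ ∧ ∫ x, fderiv ℝ h x v ∂μ = 0 := by
  have hi : Integrable (fun x => fderiv ℝ h x v) μ :=
    ((hh.continuous_fderiv one_ne_zero).clm_apply continuous_const).integrable_of_hasCompactSupport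
      (hc.fderiv_apply ℝ v)
  refine ⟨hi, ?_⟩
  have := integral_mul_fderiv_eq_neg_fderiv_mul_of_integrable (𝕜 := ℝ) (μ := μ)
    (f := fun _ => (1 : ℝ)) (g := h) (v := v) (by simp) (by simpa using hi)
    (by simpa using hh.continuous.integrable_of_hasCompactSupport hc)
    (fun _ _ => differentiableAt_const _)
    (fun x _ => hh.differentiable one_ne_zero x)
  simpa using this

/-- Energy estimate obtained by integrating by parts along `v` against a weight `p` with
logarithmic derivative `-βW`. -/
theorem lintegral_sq_mul_le_of_fderiv_weight {f p W : E → ℝ} {v : E} {β K : ℝ} (hβ : 0 < β)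
    (hK : 0 ≤ K) (hf : ContDiff ℝ 1 f) (hp : ContDiff ℝ 1 p) (hW : ContDiff ℝ 1 W)
    (hf0 : ∀ x, 0 < f x) (hp0 : ∀ x, 0 < p x)
    (hpv : ∀ x, fderiv ℝ p x v = -β * W x * p x) (hWv : ∀ x, fderiv ℝ W x v ≤ K)
    (hmass : ∫⁻ x, ENNReal.ofReal (p x * f x) ∂μ = 1) :
    ∫⁻ x, ENNReal.ofReal (p x * (W x ^ 2 * f x)) ∂μ ≤ ENNReal.ofReal (2 * K / β) +
      ENNReal.ofReal (2 / β ^ 2) *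
        ∫⁻ x, ENNReal.ofReal (p x * (fderiv ℝ f x v ^ 2 / f x)) ∂μ := by
  have hfv : Continuous fun x => fderiv ℝ f x v :=
    (hf.continuous_fderiv one_ne_zero).clm_apply continuous_const
  have hfpc : Continuous fun x => p x * f x := hp.continuous.mul hf.continuous
  have hDc : Continuous fun x => p x * (fderiv ℝ f x v ^ 2 / f x) :=
    hp.continuous.mul ((hfv.pow 2).div hf.continuous fun x => (hf0 x).ne')
  have hD0 : ∀ x, 0 ≤ p x * (fderiv ℝ f x v ^ 2 / f x) := fun x =>
    mul_nonneg (hp0 x).le (div_nonneg (sq_nonneg _) (hf0 x).le)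
  have hfp0 : ∀ x, 0 ≤ p x * f x := fun x => (mul_pos (hp0 x) (hf0 x)).le
  rcases eq_or_ne (∫⁻ x, ENNReal.ofReal (p x * (fderiv ℝ f x v ^ 2 / f x)) ∂μ) ⊤ with hD | hD
  · rw [hD, ENNReal.mul_top (by simpa using by positivity)]
    simp
  have hDi : Integrable (fun x => p x * (fderiv ℝ f x v ^ 2 / f x)) μ :=
    (lintegral_ofReal_ne_top_iff_integrable hDc.aestronglyMeasurable
      (Filter.Eventually.of_forall hD0)).1 hD
  have hfpi : Integrable (fun x => p x * f x) μ :=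
    (lintegral_ofReal_ne_top_iff_integrable hfpc.aestronglyMeasurable
      (Filter.Eventually.of_forall hfp0)).1 (by rw [hmass]; simp)
  have hfp1 : ∫ x, p x * f x ∂μ = 1 := by
    rw [integral_eq_lintegral_of_nonneg_ae (Filter.Eventually.of_forall hfp0)
      hfpc.aestronglyMeasurable, hmass]
    simp
  obtain ⟨φ, M, hφ, hφc, hφ01, hφ1, hφM⟩ := exists_cutoff_sequence v
  have hbound : ∀ n : ℕ, ∫⁻ x, ENNReal.ofReal (p x * ((W x * φ n x) ^ 2 * f x)) ∂μ ≤
      ENNReal.ofReal (2 / β * (K + 4 / β * (M / ((n : ℝ) + 1)) ^ 2)) +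
      ENNReal.ofReal (2 / β ^ 2) *
        ∫⁻ x, ENNReal.ofReal (p x * (fderiv ℝ f x v ^ 2 / f x)) ∂μ := by
    intro n
    set ε := M / ((n : ℝ) + 1)
    let h : E → ℝ := fun x => W x * φ n x ^ 2 * f x * p x
    have hh : ContDiff ℝ 1 h := ((hW.mul ((hφ n).pow 2)).mul hf).mul hp
    have hhc : HasCompactSupport h := by
      have : HasCompactSupport (φ n * fun x => W x * φ n x * f x * p x) := (hφc n).mul_right
      convert this using 1
      ext x
      simp only [h, Pi.mul_apply]
      ring
    obtain ⟨hhi, hh0⟩ := integral_fderiv_eq_zero_of_hasCompactSupport (μ := μ) hh hhc v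
    have hderiv : ∀ x, fderiv ℝ h x v = fderiv ℝ W x v * φ n x ^ 2 * f x * p x +
        2 * W x * φ n x * fderiv ℝ (φ n) x v * f x * p x +
        W x * φ n x ^ 2 * fderiv ℝ f x v * p x - β * W x ^ 2 * φ n x ^ 2 * f x * p x := by
      intro x
      have h1 := (hW.differentiable one_ne_zero x).hasFDerivAt
      have h2 := ((hφ n).differentiable one_ne_zero x).hasFDerivAt
      have h3 := (hf.differentiable one_ne_zero x).hasFDerivAt
      have h4 := (hp.differentiable one_ne_zero x).hasFDerivAt
      have h5 := (((h1.mul (h2.pow 2)).mul h3).mul h4).fderiv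
      have h6 : fderiv ℝ h x = _ := h5
      rw [h6]
      simp [hpv x]
      ring
    have hpt : ∀ x, p x * ((W x * φ n x) ^ 2 * f x) ≤
        2 / β * ((K + 4 / β * ε ^ 2) * (p x * f x) +
          1 / β * (p x * (fderiv ℝ f x v ^ 2 / f x)) - fderiv ℝ h x v) := by
      intro x
      have hfx := hf0 x
      have hpx := hp0 x
      obtain ⟨ha, hb⟩ := hφ01 n x
      have hφsq : φ n x ^ 2 ≤ 1 := pow_le_one₀ ha hb
      have hε : fderiv ℝ (φ n) x v ^ 2 ≤ ε ^ 2 := sq_le_sq' (neg_le_of_abs_le (hφM n x))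
        (le_of_abs_le (hφM n x))
      rw [hderiv x]
      generalize fderiv ℝ (φ n) x v = dφ at *
      generalize fderiv ℝ f x v = df at *
      have hWx := hWv x
      generalize fderiv ℝ W x v = dW at *
      generalize φ n x = y at *
      generalize W x = w at *
      have t1 : dW * y ^ 2 ≤ K := by nlinarith [sq_nonneg y]
      have t2 : 2 * w * y * dφ ≤ β / 4 * (w * y) ^ 2 + 4 / β * ε ^ 2 := by
        have : 2 * w * y * dφ ≤ β / 4 * (w * y) ^ 2 + 4 / β * dφ ^ 2 := by
          have : 0 ≤ β / 4 * (w * y - 4 / β * dφ) ^ 2 := by positivity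
          have e : β / 4 * (w * y - 4 / β * dφ) ^ 2 =
            β / 4 * (w * y) ^ 2 + 4 / β * dφ ^ 2 - 2 * w * y * dφ := by field_simp; ring
          linarith
        have : 4 / β * dφ ^ 2 ≤ 4 / β * ε ^ 2 := by gcongr
        linarith
      have t3 : w * y ^ 2 * df ≤ β / 4 * (w * y) ^ 2 * f x + 1 / β * (df ^ 2 / f x) := by
        have e : β / 4 * f x * (w * y - 2 / β * (y * (df / f x))) ^ 2 =
          β / 4 * (w * y) ^ 2 * f x + y ^ 2 * (1 / β * (df ^ 2 / f x)) - w * y ^ 2 * df := by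
            field_simp; ring
        have : 0 ≤ β / 4 * f x * (w * y - 2 / β * (y * (df / f x))) ^ 2 := by positivity
        have : y ^ 2 * (1 / β * (df ^ 2 / f x)) ≤ 1 * (1 / β * (df ^ 2 / f x)) := by gcongr
        linarith
      have s1 := mul_le_mul_of_nonneg_right t1 (hfp0 x)
      have s2 := mul_le_mul_of_nonneg_right t2 (hfp0 x)
      have s3 := mul_le_mul_of_nonneg_right t3 hpx.le
      rw [← sub_nonneg]
      have e : 2 / β * ((K + 4 / β * ε ^ 2) * (p x * f x) + 1 / β * (p x * (df ^ 2 / f x)) -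
          (dW * y ^ 2 * f x * p x + 2 * w * y * dφ * f x * p x + w * y ^ 2 * df * p x -
            β * w ^ 2 * y ^ 2 * f x * p x)) - p x * ((w * y) ^ 2 * f x) =
          2 / β * ((K * (p x * f x) - dW * y ^ 2 * (p x * f x)) +
          ((β / 4 * (w * y) ^ 2 + 4 / β * ε ^ 2) * (p x * f x) - 2 * w * y * dφ * (p x * f x)) +
          ((β / 4 * (w * y) ^ 2 * f x + 1 / β * (df ^ 2 / f x)) * p x - w * y ^ 2 * df * p x)) := by
        field_simp
        ring
      rw [e]
      exact mul_nonneg (by positivity) (by linarith)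
    have hLi : Integrable (fun x => p x * ((W x * φ n x) ^ 2 * f x)) μ := by
      have hcs : HasCompactSupport (φ n * fun x => W x ^ 2 * φ n x * f x * p x) :=
        (hφc n).mul_right
      have hcont : Continuous (φ n * fun x => W x ^ 2 * φ n x * f x * p x) :=
        (hφ n).continuous.mul ((((hW.continuous.pow 2).mul (hφ n).continuous).mul
          hf.continuous).mul hp.continuous)
      convert hcont.integrable_of_hasCompactSupport (μ := μ) hcs using 1
      ext x
      simp only [Pi.mul_apply]
      ring
    have hsum : Integrable (fun x => (K + 4 / β * ε ^ 2) * (p x * f x) +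
        1 / β * (p x * (fderiv ℝ f x v ^ 2 / f x))) μ :=
      (hfpi.const_mul _).add (hDi.const_mul _)
    have hint := integral_mono hLi ((hsum.sub hhi).const_mul (2 / β)) hpt
    have hRHS : ∫ x, 2 / β * ((K + 4 / β * ε ^ 2) * (p x * f x) +
        1 / β * (p x * (fderiv ℝ f x v ^ 2 / f x)) - fderiv ℝ h x v) ∂μ =
        2 / β * (K + 4 / β * ε ^ 2) +
          2 / β ^ 2 * ∫ x, p x * (fderiv ℝ f x v ^ 2 / f x) ∂μ := by
      rw [integral_const_mul, integral_sub hsum hhi,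
        integral_add (hfpi.const_mul _) (hDi.const_mul _), integral_const_mul, integral_const_mul,
        hh0, hfp1]
      field_simp
      ring
    have hint' := hint.trans_eq hRHS
    rw [← ofReal_integral_eq_lintegral_ofReal hLi (Filter.Eventually.of_forall fun x =>
        mul_nonneg (hp0 x).le (mul_nonneg (sq_nonneg _) (hf0 x).le)),
      ← ofReal_integral_eq_lintegral_ofReal hDi (Filter.Eventually.of_forall hD0),
      ← ENNReal.ofReal_mul (by positivity),
      ← ENNReal.ofReal_add (by positivity)
        (mul_nonneg (by positivity) (integral_nonneg hD0))]
    exact ENNReal.ofReal_le_ofReal hint'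
  calc ∫⁻ x, ENNReal.ofReal (p x * (W x ^ 2 * f x)) ∂μ
      = ∫⁻ x, Filter.liminf (fun n =>
          ENNReal.ofReal (p x * ((W x * φ n x) ^ 2 * f x))) Filter.atTop ∂μ := by
        refine lintegral_congr fun x => ?_
        refine (Filter.Tendsto.liminf_eq ?_).symm
        refine tendsto_const_nhds.congr' ?_
        filter_upwards [hφ1 x] with n hn
        rw [hn, mul_one]
    _ ≤ Filter.liminf (fun n => ∫⁻ x, ENNReal.ofReal (p x * ((W x * φ n x) ^ 2 * f x)) ∂μ)
          Filter.atTop := by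
        refine lintegral_liminf_le fun n => ?_
        exact ((hp.continuous.mul (((hW.continuous.mul (hφ n).continuous).pow 2).mul
          hf.continuous)).measurable).ennreal_ofReal
    _ ≤ Filter.liminf (fun n : ℕ =>
          ENNReal.ofReal (2 / β * (K + 4 / β * (M / ((n : ℝ) + 1)) ^ 2)) +
          ENNReal.ofReal (2 / β ^ 2) *
            ∫⁻ x, ENNReal.ofReal (p x * (fderiv ℝ f x v ^ 2 / f x)) ∂μ) Filter.atTop :=
        Filter.liminf_le_liminf (Filter.Eventually.of_forall hbound)
    _ = _ := by
        refine Filter.Tendsto.liminf_eq (Filter.Tendsto.add ?_ tendsto_const_nhds)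
        refine ENNReal.tendsto_ofReal ?_
        have h0 : Filter.Tendsto (fun n : ℕ => M / ((n : ℝ) + 1)) Filter.atTop (nhds 0) := by
          simpa [div_eq_mul_inv] using
            (tendsto_one_div_add_atTop_nhds_zero_nat (𝕜 := ℝ)).const_mul M
        have := ((h0.pow 2).const_mul (4 / β)).const_add K |>.const_mul (2 / β)
        convert this using 2
        simp
        ring

end Cutoff

section Blocks

variable {N : ℕ}

/-- The coordinate vector with 0-based index `n`, which vanishes when `n` is out of range. -/
def coordVec (N n : ℕ) : Fin N → ℝ := fun k => if k.1 = n then 1 else 0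

/-- The indicator of the block of `l` sites starting at the 0-based index `s`. -/
def blockVec (N l s : ℕ) : Fin N → ℝ := fun k => if s ≤ k.1 ∧ k.1 < s + l then 1 else 0

/-- The difference of the averages over the two blocks of length `l` adjacent at site `i`. -/
noncomputable def twoBlockVec (N l i : ℕ) : Fin N → ℝ :=
  (1 / (l : ℝ)) • (blockVec N l i - blockVec N l (i - l))

theorem coordVec_eq_single {n : ℕ} (h : n < N) : coordVec N n = Pi.single ⟨n, h⟩ 1 := by
  ext k
  simp [coordVec, Pi.single_apply, Fin.ext_iff]

theorem blockVec_eq_sum (l s : ℕ) :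
    blockVec N l s = ∑ j ∈ Finset.range l, coordVec N (s + j) := by
  ext k
  simp only [blockVec, coordVec, Finset.sum_apply]
  split_ifs with h
  · rw [Finset.sum_eq_single (k.1 - s)]
    · rw [if_pos (by omega)]
    · intro b _ hb
      rw [if_neg (by omega)]
    · intro hb
      exact absurd (Finset.mem_range.2 (by omega)) hb
  · refine (Finset.sum_eq_zero fun j hj => if_neg ?_).symm
    have := Finset.mem_range.1 hj
    omega

theorem sum_coordVec_mul {n : ℕ} (h : n < N) (u : Fin N → ℝ) :
    ∑ k, coordVec N n k * u k = u ⟨n, h⟩ := by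
  simp [coordVec_eq_single h, Pi.single_apply]

theorem sum_coordVec_mul_one_le (n : ℕ) : ∑ k, coordVec N n k ≤ 1 := by
  by_cases h : n < N
  · simpa using (sum_coordVec_mul h 1).le
  · refine (Finset.sum_eq_zero fun k _ => if_neg ?_).trans_le zero_le_one
    have := k.2
    omega

theorem sum_blockVec_le (l s : ℕ) : ∑ k, blockVec N l s k ≤ l := by
  simp only [blockVec_eq_sum, Finset.sum_apply]
  rw [Finset.sum_comm]
  refine (Finset.sum_le_sum fun j _ => sum_coordVec_mul_one_le (s + j)).trans ?_
  simp

theorem sum_blockVec_eq {l s : ℕ} (h : s + l ≤ N) : ∑ k, blockVec N l s k = l := by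
  simp only [blockVec_eq_sum, Finset.sum_apply]
  rw [Finset.sum_comm, Finset.sum_congr rfl (g := fun _ => (1 : ℝ))]
  · simp
  · intro j hj
    have := Finset.mem_range.1 hj
    simpa using sum_coordVec_mul (N := N) (n := s + j) (by omega) 1

theorem forceBlockAvg_eq_sum (V : ℝ → ℝ) {l s : ℕ} (h : s + l ≤ N) (x : Fin N → ℝ) :
    forceBlockAvg V l (s + l) x = (1 / (l : ℝ)) * ∑ k, blockVec N l s k * deriv V (x k) := by
  unfold forceBlockAvg
  congr 1
  simp only [blockVec_eq_sum, Finset.sum_apply, Finset.sum_mul]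
  rw [Finset.sum_comm]
  refine Finset.sum_nbij' (fun j => l - j) (fun j => l - j) ?_ ?_ ?_ ?_ ?_
  · intro j hj
    simp only [Finset.mem_Icc, Finset.mem_range] at *
    omega
  · intro j hj
    simp only [Finset.mem_Icc, Finset.mem_range] at *
    omega
  · intro j hj
    simp only [Finset.mem_Icc] at hj
    omega
  · intro j hj
    simp only [Finset.mem_range] at hj
    omega
  · intro j hj
    simp only [Finset.mem_Icc] at hj
    have hlt : s + (l - j) < N := by omega
    rw [sum_coordVec_mul hlt fun k => deriv V (x k)]
    have hidx : s + l - j + 1 - 1 = s + (l - j) := by omega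
    simp only [coord, hidx, dif_pos hlt]

theorem forceBlockAvg_sub_eq_sum (V : ℝ → ℝ) {l i : ℕ} (hl : l ≤ i) (h : i + l ≤ N)
    (x : Fin N → ℝ) :
    forceBlockAvg V l (i + l) x - forceBlockAvg V l i x =
      ∑ k, twoBlockVec N l i k * deriv V (x k) := by
  have h2 := forceBlockAvg_eq_sum V (l := l) (s := i - l) (by omega) x
  rw [Nat.sub_add_cancel hl] at h2
  rw [forceBlockAvg_eq_sum V h, h2, ← mul_sub, ← Finset.sum_sub_distrib, Finset.mul_sum]
  refine Finset.sum_congr rfl fun k _ => ?_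
  simp only [twoBlockVec, Pi.smul_apply, Pi.sub_apply, smul_eq_mul]
  ring

theorem sum_twoBlockVec {l i : ℕ} (h : i + l ≤ N) : ∑ k, twoBlockVec N l i k = 0 := by
  simp only [twoBlockVec, Pi.smul_apply, Pi.sub_apply, smul_eq_mul]
  rw [← Finset.mul_sum, Finset.sum_sub_distrib, sum_blockVec_eq h, sum_blockVec_eq (by omega)]
  simp

theorem sum_sq_twoBlockVec_le {l : ℕ} (hl : 1 ≤ l) (i : ℕ) :
    ∑ k, twoBlockVec N l i k ^ 2 ≤ 2 / l := by
  have hl0 : (0 : ℝ) < l := by exact_mod_cast hl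
  have hpt : ∀ k, twoBlockVec N l i k ^ 2 ≤
      1 / (l : ℝ) ^ 2 * (blockVec N l i k + blockVec N l (i - l) k) := by
    intro k
    simp only [twoBlockVec, Pi.smul_apply, Pi.sub_apply, smul_eq_mul, mul_pow, div_pow, one_pow]
    gcongr
    simp only [blockVec]
    split_ifs <;> norm_num
  refine (Finset.sum_le_sum fun k _ => hpt k).trans ?_
  rw [← Finset.mul_sum, Finset.sum_add_distrib]
  calc _ ≤ 1 / (l : ℝ) ^ 2 * ((l : ℝ) + l) := by gcongr <;> exact sum_blockVec_le _ _
    _ = 2 / (l : ℝ) := by field_simp; ring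

/-- Telescoping bound for a linear functional along two adjacent blocks. -/
theorem sq_apply_twoBlockVec_le (L : (Fin N → ℝ) →L[ℝ] ℝ) {l i : ℕ} (hl : 1 ≤ l) (hi : l ≤ i) :
    L (twoBlockVec N l i) ^ 2 ≤ ∑ j ∈ Finset.range l, ∑ t ∈ Finset.range l,
      (L (coordVec N (i - l + j + t + 1)) - L (coordVec N (i - l + j + t))) ^ 2 := by
  have hl0 : (0 : ℝ) < l := by exact_mod_cast hl
  set g : ℕ → ℝ := fun n => L (coordVec N n)
  have h1 : L (twoBlockVec N l i) = 1 / (l : ℝ) * ∑ j ∈ Finset.range l,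
      ∑ t ∈ Finset.range l, (g (i - l + j + t + 1) - g (i - l + j + t)) := by
    simp only [twoBlockVec, map_smul, map_sub, blockVec_eq_sum, map_sum, smul_eq_mul]
    rw [← Finset.sum_sub_distrib]
    congr 1
    refine Finset.sum_congr rfl fun j _ => ?_
    have := Finset.sum_range_sub (fun t => g (i - l + j + t)) l
    simp only [add_zero] at this
    rw [show i + j = i - l + j + l by omega]
    exact this.symm
  rw [h1, ← Finset.sum_product', ← Finset.sum_product', mul_pow]
  have h2 := sq_sum_le_card_mul_sum_sq (s := Finset.range l ×ˢ Finset.range l)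
    (f := fun q : ℕ × ℕ => g (i - l + q.1 + q.2 + 1) - g (i - l + q.1 + q.2))
  rw [Finset.card_product, Finset.card_range] at h2
  push_cast at h2
  calc _ ≤ (1 / (l : ℝ)) ^ 2 * _ := mul_le_mul_of_nonneg_left h2 (by positivity)
    _ = _ := by
      field_simp
      rfl

theorem sum_sq_apply_twoBlockVec_le (L : (Fin N → ℝ) →L[ℝ] ℝ) {l : ℕ} (hl : 1 ≤ l) :
    ∑ i ∈ Finset.Icc (l + 1) (N - l), L (twoBlockVec N l i) ^ 2 ≤
      (l : ℝ) ^ 2 * ∑ m : Fin (N - 1),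
        (L (Pi.single (⟨m.1 + 1, by have := m.isLt; omega⟩ : Fin N) 1) -
          L (Pi.single (⟨m.1, by have := m.isLt; omega⟩ : Fin N) 1)) ^ 2 := by
  set d : ℕ → ℝ := fun n => (L (coordVec N (n + 1)) - L (coordVec N n)) ^ 2
  have hd : ∑ m : Fin (N - 1),
        (L (Pi.single (⟨m.1 + 1, by have := m.isLt; omega⟩ : Fin N) 1) -
          L (Pi.single (⟨m.1, by have := m.isLt; omega⟩ : Fin N) 1)) ^ 2 =
      ∑ m ∈ Finset.range (N - 1), d m := by
    rw [Finset.sum_range]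
    refine Finset.sum_congr rfl fun m _ => ?_
    have := m.isLt
    simp only [d]
    rw [coordVec_eq_single (by omega), coordVec_eq_single (by omega)]
  rw [hd]
  calc _ ≤ ∑ i ∈ Finset.Icc (l + 1) (N - l), ∑ j ∈ Finset.range l, ∑ t ∈ Finset.range l,
        d (i - l + j + t) := by
        refine Finset.sum_le_sum fun i hi => ?_
        have := Finset.mem_Icc.1 hi
        exact sq_apply_twoBlockVec_le L hl (by omega)
    _ = ∑ j ∈ Finset.range l, ∑ t ∈ Finset.range l, ∑ i ∈ Finset.Icc (l + 1) (N - l),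
        d (i - l + j + t) := by
        rw [Finset.sum_comm]
        exact Finset.sum_congr rfl fun j _ => Finset.sum_comm
    _ ≤ ∑ j ∈ Finset.range l, ∑ t ∈ Finset.range l, ∑ m ∈ Finset.range (N - 1), d m := by
        refine Finset.sum_le_sum fun j hj => Finset.sum_le_sum fun t ht => ?_
        have hj := Finset.mem_range.1 hj
        have ht := Finset.mem_range.1 ht
        rw [← Finset.sum_image (f := d) (g := fun i => i - l + j + t)]
        · refine Finset.sum_le_sum_of_subset_of_nonneg ?_ fun m _ _ => sq_nonneg _
          intro m hm
          obtain ⟨i, hi, rfl⟩ := Finset.mem_image.1 hm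
          have := Finset.mem_Icc.1 hi
          exact Finset.mem_range.2 (by omega)
        · intro a ha b hb hab
          have ha := Finset.mem_Icc.1 ha
          have hb := Finset.mem_Icc.1 hb
          simp only at hab
          omega
    _ = _ := by
        simp only [Finset.sum_const, Finset.card_range, nsmul_eq_mul]
        ring

end Blocks

section Gibbs

/-- Evaluation at a coordinate as a continuous linear functional. -/
def coordCLM {N : ℕ} (k : Fin N) : (Fin N → ℝ) →L[ℝ] ℝ :=
  ContinuousLinearMap.proj (R := ℝ) (φ := fun _ => ℝ) k

theorem coordCLM_apply {N : ℕ} (k : Fin N) (x : Fin N → ℝ) : coordCLM k x = x k := rfl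

theorem hasFDerivAt_coordCLM {N : ℕ} (k : Fin N) (x : Fin N → ℝ) :
    HasFDerivAt (fun x : Fin N → ℝ => x k) (coordCLM k) x :=
  (coordCLM k).hasFDerivAt

theorem contDiff_one_deriv {V : ℝ → ℝ} (hV : ContDiff ℝ 2 V) : ContDiff ℝ 1 (deriv V) :=
  (contDiff_succ_iff_deriv (n := 1).1 (by simpa [one_add_one_eq_two] using hV)).2.2

theorem contDiff_sum_mul_deriv {N : ℕ} {V : ℝ → ℝ} (hV : ContDiff ℝ 2 V) (v : Fin N → ℝ) :
    ContDiff ℝ 1 fun x : Fin N → ℝ => ∑ k, v k * deriv V (x k) :=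
  ContDiff.sum fun k _ => contDiff_const.mul ((contDiff_one_deriv hV).comp (contDiff_apply ℝ ℝ k))

theorem fderiv_sum_mul_deriv {N : ℕ} {V : ℝ → ℝ} (hV : ContDiff ℝ 2 V) (v x : Fin N → ℝ) :
    fderiv ℝ (fun x : Fin N → ℝ => ∑ k, v k * deriv V (x k)) x v =
      ∑ k, v k ^ 2 * deriv (deriv V) (x k) := by
  have h : HasFDerivAt (fun x : Fin N → ℝ => ∑ k, v k * deriv V (x k))
      (∑ k, v k • (deriv (deriv V) (x k) • coordCLM k)) x := by
    refine HasFDerivAt.fun_sum fun k _ => HasFDerivAt.const_mul ?_ (v k)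
    exact (((contDiff_one_deriv hV).differentiable one_ne_zero (x k)).hasDerivAt).comp_hasFDerivAt x
      (hasFDerivAt_coordCLM k x)
  rw [h.fderiv]
  simp only [_root_.sum_apply, smul_apply,
    coordCLM_apply, smul_eq_mul]
  exact Finset.sum_congr rfl fun k _ => by ring

variable (β : ℝ) (V : ℝ → ℝ) (τ : ℝ) {N : ℕ}

theorem prod_gibbsDensity (x : Fin N → ℝ) : ∏ i, gibbsDensity β V τ (x i) =
    Real.exp (∑ i, (-β * V (x i) + β * τ * x i - gibbsG β V τ)) := by
  simp only [gibbsDensity, Real.exp_sum]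

variable {V}

theorem contDiff_prod_gibbsDensity (hV : ContDiff ℝ 2 V) :
    ContDiff ℝ 1 fun x : Fin N → ℝ => ∏ i, gibbsDensity β V τ (x i) := by
  simp only [prod_gibbsDensity]
  refine Real.contDiff_exp.comp (ContDiff.sum fun k _ => ?_)
  have hk := contDiff_apply (n := 1) ℝ ℝ k
  exact ((contDiff_const.mul ((hV.of_le one_le_two).comp hk)).add (contDiff_const.mul hk)).sub
    contDiff_const

/-- Along a direction of zero total stretch, the tension does not contribute to the logarithmic
derivative of the Gibbs density. -/
theorem fderiv_prod_gibbsDensity (hV : ContDiff ℝ 2 V) {v : Fin N → ℝ} (hv : ∑ k, v k = 0)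
    (x : Fin N → ℝ) :
    fderiv ℝ (fun x : Fin N → ℝ => ∏ i, gibbsDensity β V τ (x i)) x v =
      -β * (∑ k, v k * deriv V (x k)) * ∏ i, gibbsDensity β V τ (x i) := by
  simp only [prod_gibbsDensity]
  have h : HasFDerivAt
      (fun x : Fin N → ℝ => ∑ k, (-β * V (x k) + β * τ * x k - gibbsG β V τ))
      (∑ k, ((-β) • (deriv V (x k) • coordCLM k) +
        (β * τ) • coordCLM k)) x := by
    refine HasFDerivAt.fun_sum fun k _ => HasFDerivAt.sub_const _ ?_
    have hk := hasFDerivAt_coordCLM k x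
    refine HasFDerivAt.add (HasFDerivAt.const_mul ?_ _) (hk.const_mul _)
    exact ((hV.differentiable two_ne_zero (x k)).hasDerivAt).comp_hasFDerivAt x hk
  rw [h.exp.fderiv]
  simp only [_root_.sum_apply, smul_apply,
    add_apply, coordCLM_apply, smul_eq_mul]
  rw [Finset.sum_add_distrib, ← Finset.mul_sum, ← Finset.mul_sum, hv]
  simp only [mul_comm (deriv V _)]
  ring

theorem lintegral_gibbsPi (hV : ContDiff ℝ 2 V) (g : (Fin N → ℝ) → ℝ) :
    ∫⁻ x, ENNReal.ofReal (g x) ∂(gibbsPi β V τ N) =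
      ∫⁻ x, ENNReal.ofReal ((∏ i, gibbsDensity β V τ (x i)) * g x) := by
  have hp := (contDiff_prod_gibbsDensity (N := N) β τ hV).continuous.measurable.ennreal_ofReal
  rw [gibbsPi, lintegral_withDensity_eq_lintegral_mul_non_measurable _ hp
    (Filter.Eventually.of_forall fun _ => ENNReal.ofReal_lt_top)]
  refine lintegral_congr fun x => ?_
  rw [Pi.mul_apply, ENNReal.ofReal_mul]
  rw [prod_gibbsDensity]
  positivity

variable {β}

theorem lintegral_sq_forceBlockAvg_sub_le {c : ℝ} (hβ : 0 < β) (hc : 0 ≤ c)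
    (hV : ContDiff ℝ 2 V) (hVc : ∀ r, deriv (deriv V) r ≤ c) {l i : ℕ} (hl : 1 ≤ l) (hi : l ≤ i)
    (hiN : i + l ≤ N) {f : (Fin N → ℝ) → ℝ} (hf : ContDiff ℝ 1 f) (hf0 : ∀ x, 0 < f x)
    (hmass : ∫⁻ x, ENNReal.ofReal (f x) ∂(gibbsPi β V τ N) = 1) :
    ∫⁻ x, ENNReal.ofReal
        ((forceBlockAvg V l (i + l) x - forceBlockAvg V l i x) ^ 2 * f x) ∂(gibbsPi β V τ N) ≤
      ENNReal.ofReal (2 * (2 * c / l) / β) + ENNReal.ofReal (2 / β ^ 2) *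
        ∫⁻ x, ENNReal.ofReal (fderiv ℝ f x (twoBlockVec N l i) ^ 2 / f x)
          ∂(gibbsPi β V τ N) := by
  simp only [lintegral_gibbsPi β τ hV] at hmass ⊢
  simp only [forceBlockAvg_sub_eq_sum V hi hiN]
  refine lintegral_sq_mul_le_of_fderiv_weight hβ (by positivity) hf
    (contDiff_prod_gibbsDensity β τ hV) (contDiff_sum_mul_deriv hV _) hf0 (fun x => ?_)
    (fderiv_prod_gibbsDensity β τ hV (sum_twoBlockVec hiN)) (fun x => ?_) hmass
  · rw [prod_gibbsDensity]
    positivity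
  · rw [fderiv_sum_mul_deriv hV]
    calc ∑ k, twoBlockVec N l i k ^ 2 * deriv (deriv V) (x k)
        ≤ ∑ k, twoBlockVec N l i k ^ 2 * c :=
          Finset.sum_le_sum fun k _ => mul_le_mul_of_nonneg_left (hVc _) (sq_nonneg _)
      _ = (∑ k, twoBlockVec N l i k ^ 2) * c := (Finset.sum_mul _ _ _).symm
      _ ≤ 2 / l * c := mul_le_mul_of_nonneg_right (sum_sq_twoBlockVec_le hl i) hc
      _ = 2 * c / l := by ring

variable (β) in
theorem sum_lintegral_sq_fderiv_twoBlockVec_le {l : ℕ} (hl : 1 ≤ l)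
    {f : (Fin N → ℝ) → ℝ} (hf : ContDiff ℝ 1 f) (hf0 : ∀ x, 0 < f x) :
    ∑ i ∈ Finset.Icc (l + 1) (N - l),
        ∫⁻ x, ENNReal.ofReal (fderiv ℝ f x (twoBlockVec N l i) ^ 2 / f x) ∂(gibbsPi β V τ N) ≤
      (l : ℝ≥0∞) ^ 2 * stretchDirichlet β V τ N f := by
  have hfv : ∀ v, Measurable fun x => fderiv ℝ f x v := fun v =>
    ((hf.continuous_fderiv one_ne_zero).clm_apply continuous_const).measurable
  have hfm := hf.continuous.measurable
  unfold stretchDirichlet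
  rw [← lintegral_finsetSum, ← lintegral_finsetSum, ← lintegral_const_mul' _ _ (by simp)]
  rotate_left
  · exact fun m _ => ((((hfv _).sub (hfv _)).pow_const 2).div hfm).ennreal_ofReal
  · exact fun i _ => (((hfv _).pow_const 2).div hfm).ennreal_ofReal
  refine lintegral_mono fun x => ?_
  have hfx := hf0 x
  rw [← ENNReal.ofReal_sum_of_nonneg fun i _ => by positivity,
    ← ENNReal.ofReal_sum_of_nonneg fun i _ => by positivity,
    ← ENNReal.ofReal_natCast, ← ENNReal.ofReal_pow (by positivity),
    ← ENNReal.ofReal_mul (by positivity)]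
  refine ENNReal.ofReal_le_ofReal ?_
  rw [← Finset.sum_div, ← Finset.sum_div, ← mul_div_assoc]
  gcongr
  exact sum_sq_apply_twoBlockVec_le (fderiv ℝ f x) hl

end Gibbs


/-- two-block estimate, force version. There is a constant `C`,
depending only on `β` and `c₂`, such that for all `l ≥ 1`, `N ≥ 2l+1` and every smooth
strictly positive probability density `f` with respect to `λ^N_{β,τ₀}`:
`Σ_{i=l+1}^{N-l} ∫ (V̄'_{l,i+l} - V̄'_{l,i})² f dλ^N ≤ C (N/l + l² D̃(f))`. -/
theorem two_block_estimate_force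
    (β c₂ : ℝ) (hβ : 0 < β) (hc₂ : 0 < c₂) :
    ∃ C : ℝ, 0 < C ∧
      ∀ (c₁ : ℝ), 0 < c₁ → c₁ ≤ c₂ →
      ∀ (V : ℝ → ℝ), ContDiff ℝ 2 V →
        (∀ r : ℝ, c₁ ≤ deriv (deriv V) r ∧ deriv (deriv V) r ≤ c₂) →
      ∀ (τ₀ : ℝ) (N l : ℕ), 1 ≤ l → 2 * l + 1 ≤ N →
      ∀ (f : (Fin N → ℝ) → ℝ), ContDiff ℝ (⊤ : ℕ∞) f → (∀ x, 0 < f x) →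
        (∫⁻ x, ENNReal.ofReal (f x) ∂(gibbsPi β V τ₀ N)) = 1 →
        (∑ i ∈ Finset.Icc (l + 1) (N - l),
          ∫⁻ x, ENNReal.ofReal
            ((forceBlockAvg V l (i + l) x - forceBlockAvg V l i x) ^ 2 * f x)
            ∂(gibbsPi β V τ₀ N)) ≤
          ENNReal.ofReal C *
            (ENNReal.ofReal ((N : ℝ) / (l : ℝ)) +
              (l : ℝ≥0∞) ^ 2 * stretchDirichlet β V τ₀ N f) := by
  refine ⟨4 * c₂ / β + 2 / β ^ 2, by positivity, ?_⟩
  intro c₁ _ _ V hV hVc τ₀ N l hl hN f hf hf0 hmass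
  have hf1 : ContDiff ℝ 1 f := hf.of_le (by exact_mod_cast le_top)
  have hl0 : (0 : ℝ) < l := by exact_mod_cast hl
  calc _ ≤ ∑ i ∈ Finset.Icc (l + 1) (N - l), (ENNReal.ofReal (2 * (2 * c₂ / l) / β) +
          ENNReal.ofReal (2 / β ^ 2) *
            ∫⁻ x, ENNReal.ofReal (fderiv ℝ f x (twoBlockVec N l i) ^ 2 / f x)
              ∂(gibbsPi β V τ₀ N)) := by
        refine Finset.sum_le_sum fun i hi => ?_
        have := Finset.mem_Icc.1 hi
        exact lintegral_sq_forceBlockAvg_sub_le τ₀ hβ hc₂.le hV (fun r => (hVc r).2) hl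
          (by omega) (by omega) hf1 hf0 hmass
    _ ≤ N * ENNReal.ofReal (2 * (2 * c₂ / l) / β) + ENNReal.ofReal (2 / β ^ 2) *
          ((l : ℝ≥0∞) ^ 2 * stretchDirichlet β V τ₀ N f) := by
        rw [Finset.sum_add_distrib, ← Finset.mul_sum, Finset.sum_const, nsmul_eq_mul,
          Nat.card_Icc]
        gcongr
        · omega
        · exact sum_lintegral_sq_fderiv_twoBlockVec_le β τ₀ hl hf1 hf0
    _ = ENNReal.ofReal (4 * c₂ / β) * ENNReal.ofReal ((N : ℝ) / (l : ℝ)) +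
          ENNReal.ofReal (2 / β ^ 2) * ((l : ℝ≥0∞) ^ 2 * stretchDirichlet β V τ₀ N f) := by
        rw [← ENNReal.ofReal_natCast N, ← ENNReal.ofReal_mul (by positivity),
          ← ENNReal.ofReal_mul (by positivity)]
        congr 2
        field_simp
        ring
    _ ≤ _ := by
        rw [mul_add]
        gcongr
        · exact le_add_of_nonneg_right (by positivity)
        · exact le_add_of_nonneg_left (by positivity)
end
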